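/- Let n ≥ 1, R > 0 and let f : ℝⁿ → ℝ be a C¹ function such that there exist constants m₁, m₂ > 0 with f(p)² − m₁ (1+|p|²)² log(1+|p|²) |∇_p f(p)|² ≥ 0 and |f(p)| ≤ m₂ for all p ∈ ℝⁿ. Let u be a function on B_R(0) ⊂ ℝⁿ that is C¹ on B_R(0) and C³ on B_R(0) ∩ {|∇u| > 0}, and that satisfies div(∇u/√(1+|∇u|²)) = f(∇u) on B_R(0). Set L = sup_{x,y ∈ B_R(0)} |u(x) − u(y)|. Then there exists a constant C > 0 depending only on n, m₁, m₂ such that |∇u(0)|² ≤ max{ exp(C (L+1)² / R²) − 1 , exp(C (L+1)² / R^{2/3}) − 1 }. -/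

import Mathlib

open Metric Real Filter

noncomputable def pd1 {n : ℕ} (u : EuclideanSpace ℝ (Fin n) → ℝ) (i : Fin n)
    (x : EuclideanSpace ℝ (Fin n)) : ℝ :=
  fderiv ℝ u x (EuclideanSpace.single i 1)

noncomputable def pd2 {n : ℕ} (u : EuclideanSpace ℝ (Fin n) → ℝ) (i j : Fin n)
    (x : EuclideanSpace ℝ (Fin n)) : ℝ :=
  fderiv ℝ (pd1 u j) x (EuclideanSpace.single i 1)

/-- The coefficients `a^{ij} = δ^{ij} - u_i u_j / (1 + |∇u|²)` of the
nondivergence form of the mean curvature operator. -/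
noncomputable def aCoef {n : ℕ} (u : EuclideanSpace ℝ (Fin n) → ℝ) (i j : Fin n)
    (x : EuclideanSpace ℝ (Fin n)) : ℝ :=
  (if i = j then (1 : ℝ) else 0) - pd1 u i x * pd1 u j x / (1 + ‖gradient u x‖ ^ 2)

/-- The mean curvature operator in nondivergence form: `a^{ij} u_{ij}`. -/
noncomputable def mcOp {n : ℕ} (u : EuclideanSpace ℝ (Fin n) → ℝ)
    (x : EuclideanSpace ℝ (Fin n)) : ℝ :=
  ∑ i, ∑ j, aCoef u i j x * pd2 u i j x

open scoped Topology RealInnerProductSpace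

section
variable {ι V : Type*} [Fintype ι] [NormedAddCommGroup V] [InnerProductSpace ℝ V]

/-- Contracting `M` twice with the frame `e i - c ⟪p, e i⟫ p` is the same as contracting it with
the inverse metric `I - p ⊗ p / w`. -/
theorem sum_inner_tilted_frame (e : OrthonormalBasis ι ℝ V) (p : V) {c w : ℝ}
    (hc : 2 * c - c ^ 2 * ‖p‖ ^ 2 = 1 / w) (M : V →L[ℝ] V) :
    ∑ i, ⟪M (e i - (c * ⟪p, e i⟫) • p), e i - (c * ⟪p, e i⟫) • p⟫ =
      ∑ i, ⟪M (e i), e i⟫ - ⟪M p, p⟫ / w := by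
  have h1 : ∑ i, ⟪p, e i⟫ * ⟪M p, e i⟫ = ⟪M p, p⟫ := by
    rw [← e.sum_inner_mul_inner (M p) p]
    exact Finset.sum_congr rfl fun i _ => by rw [real_inner_comm (e i) p]; ring
  have h2 : ∑ i, ⟪p, e i⟫ * ⟪M (e i), p⟫ = ⟪M p, p⟫ := by
    conv_rhs => rw [← e.sum_repr' p]
    rw [map_sum, sum_inner]
    refine Finset.sum_congr rfl fun i _ => ?_
    rw [map_smul, real_inner_smul_left, e.sum_repr', real_inner_comm]
  have h3 : ∑ i, ⟪p, e i⟫ ^ 2 = ‖p‖ ^ 2 := by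
    rw [← real_inner_self_eq_norm_sq, ← e.sum_inner_mul_inner p p]
    exact Finset.sum_congr rfl fun i _ => by rw [real_inner_comm (e i) p]; ring
  have h4 : ∀ i, ⟪M (e i - (c * ⟪p, e i⟫) • p), e i - (c * ⟪p, e i⟫) • p⟫ =
      ⟪M (e i), e i⟫ - c * (⟪p, e i⟫ * ⟪M p, e i⟫) - c * (⟪p, e i⟫ * ⟪M (e i), p⟫)
        + c ^ 2 * ⟪M p, p⟫ * ⟪p, e i⟫ ^ 2 := fun i => by
    simp only [map_sub, map_smul, inner_sub_left, inner_sub_right, real_inner_smul_left,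
      real_inner_smul_right]
    ring
  simp only [h4, Finset.sum_add_distrib, Finset.sum_sub_distrib, ← Finset.mul_sum, h1, h2, h3]
  rw [div_eq_mul_one_div, ← hc]
  ring

theorem sum_inner_sq_tilted_frame (e : OrthonormalBasis ι ℝ V) (p q : V) {c w : ℝ}
    (hc : 2 * c - c ^ 2 * ‖p‖ ^ 2 = 1 / w) :
    ∑ i, ⟪q, e i - (c * ⟪p, e i⟫) • p⟫ ^ 2 = ‖q‖ ^ 2 - ⟪q, p⟫ ^ 2 / w := by
  have h := sum_inner_tilted_frame e p hc ((innerSL ℝ q).smulRight q)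
  have h3 : ∑ i, ⟪q, e i⟫ ^ 2 = ‖q‖ ^ 2 := by
    rw [← real_inner_self_eq_norm_sq, ← e.sum_inner_mul_inner q q]
    exact Finset.sum_congr rfl fun i _ => by rw [real_inner_comm (e i) q]; ring
  simp only [ContinuousLinearMap.smulRight_apply, innerSL_apply_apply, real_inner_smul_left,
    ← pow_two, h3] at h
  exact h

theorem sum_norm_sq_tilted_frame_le (e : OrthonormalBasis ι ℝ V) (p : V) {c w : ℝ}
    (hc : 2 * c - c ^ 2 * ‖p‖ ^ 2 = 1 / w) (hw : 0 < w) :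
    ∑ i, ‖e i - (c * ⟪p, e i⟫) • p‖ ^ 2 ≤ Fintype.card ι := by
  have h := sum_inner_tilted_frame e p hc (ContinuousLinearMap.id ℝ V)
  simp only [ContinuousLinearMap.id_apply, real_inner_self_eq_norm_sq, e.norm_eq_one, one_pow,
    Finset.sum_const, nsmul_eq_mul, mul_one, Finset.card_univ] at h
  rw [h]
  have : 0 ≤ ‖p‖ ^ 2 / w := by positivity
  linarith

theorem sq_tilted_trace_le (e : OrthonormalBasis ι ℝ V) (p : V) {c w : ℝ}
    (hc : 2 * c - c ^ 2 * ‖p‖ ^ 2 = 1 / w) (hw : 0 < w) (A : V →L[ℝ] V) :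
    (∑ i, ⟪A (e i), e i⟫ - ⟪A p, p⟫ / w) ^ 2 ≤
      Fintype.card ι * ∑ i, ‖A (e i - (c * ⟪p, e i⟫) • p)‖ ^ 2 := by
  rw [← sum_inner_tilted_frame e p hc A]
  set v : ι → V := fun i => e i - (c * ⟪p, e i⟫) • p
  calc (∑ i, ⟪A (v i), v i⟫) ^ 2
      ≤ (∑ i, ‖A (v i)‖ * ‖v i‖) ^ 2 := by
        refine sq_le_sq' ?_ (Finset.sum_le_sum fun i _ => real_inner_le_norm _ _)
        rw [← Finset.sum_neg_distrib]
        exact Finset.sum_le_sum fun i _ => neg_le_of_abs_le (abs_real_inner_le_norm _ _)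
    _ ≤ (∑ i, ‖A (v i)‖ ^ 2) * ∑ i, ‖v i‖ ^ 2 := Finset.sum_mul_sq_le_sq_mul_sq _ _ _
    _ ≤ (∑ i, ‖A (v i)‖ ^ 2) * Fintype.card ι := by
        gcongr
        exact sum_norm_sq_tilted_frame_le e p hc hw
    _ = _ := mul_comm _ _

theorem tilted_norm_sq_apply_le (e : OrthonormalBasis ι ℝ V) (p : V) {c w : ℝ}
    (hc : 2 * c - c ^ 2 * ‖p‖ ^ 2 = 1 / w) (A : V →L[ℝ] V)
    (hA : ∀ x y, ⟪A x, y⟫ = ⟪x, A y⟫) :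
    ‖A p‖ ^ 2 - ⟪A p, p⟫ ^ 2 / w ≤ ‖p‖ ^ 2 * ∑ i, ‖A (e i - (c * ⟪p, e i⟫) • p)‖ ^ 2 := by
  rw [← sum_inner_sq_tilted_frame e p (A p) hc, Finset.mul_sum]
  refine Finset.sum_le_sum fun i _ => ?_
  rw [hA, ← mul_pow]
  exact sq_le_sq' (neg_le_of_abs_le (abs_real_inner_le_norm _ _)) (real_inner_le_norm _ _)

theorem tilted_norm_sq_add_le (e : OrthonormalBasis ι ℝ V) (p x y : V) {c w : ℝ}
    (hc : 2 * c - c ^ 2 * ‖p‖ ^ 2 = 1 / w) :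
    ‖x + y‖ ^ 2 - ⟪x + y, p⟫ ^ 2 / w ≤
      2 * (‖x‖ ^ 2 - ⟪x, p⟫ ^ 2 / w) + 2 * (‖y‖ ^ 2 - ⟪y, p⟫ ^ 2 / w) := by
  simp only [← sum_inner_sq_tilted_frame e p _ hc, Finset.mul_sum, ← Finset.sum_add_distrib]
  refine Finset.sum_le_sum fun i _ => ?_
  rw [inner_add_left]
  nlinarith [sq_nonneg (⟪x, e i - (c * ⟪p, e i⟫) • p⟫ - ⟪y, e i - (c * ⟪p, e i⟫) • p⟫)]

/-- The inequality obtained by contracting the second order condition at a maximum point of the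
auxiliary function with the inverse metric, after using the differentiated equation. -/
theorem contracted_maximum_inequality (e : OrthonormalBasis ι ℝ V) {A B : V →L[ℝ] V}
    {p q σ d : V} {c w W s r b₁ b₂ f ψ : ℝ}
    (hc : 2 * c - c ^ 2 * ‖p‖ ^ 2 = 1 / w) (hs : 0 < s) (hW : 0 < W) (hWw : W ^ 2 = w)
    (hw : w = 1 + ‖p‖ ^ 2) (hψ : 0 < ψ)
    (hq : q = (2 / s) • σ + b₁ • p) (hAp : A p = -(w * ψ / 2) • q)
    (hmax : ∀ v, 2 * (-r * ‖v‖ ^ 2) / s - 2 * ⟪σ, v⟫ ^ 2 / s ^ 2 + b₂ * ⟪p, v⟫ ^ 2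
      + b₁ * ⟪A v, v⟫ + 2 * (⟪B v, v⟫ + ‖A v‖ ^ 2) / (w * ψ)
      - 4 * ⟪A p, v⟫ ^ 2 * (ψ + 1) / (w * ψ) ^ 2 ≤ 0)
    (heq : ∑ i, ⟪A (e i), e i⟫ - ⟪A p, p⟫ / w = W * f)
    (hdeq : ∑ i, ⟪B (e i), e i⟫ - ⟪B p, p⟫ / w =
      2 / w * (‖A p‖ ^ 2 - ⟪A p, p⟫ ^ 2 / w) + ⟪A p, p⟫ * f / W + W * ⟪d, A p⟫) :
    ψ * b₂ * ‖p‖ ^ 2 / w + 2 / w * ∑ i, ‖A (e i - (c * ⟪p, e i⟫) • p)‖ ^ 2 ≤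
      2 * r * ψ / s * ∑ i, ‖e i - (c * ⟪p, e i⟫) • p‖ ^ 2
        + 2 * ψ / s ^ 2 * (‖σ‖ ^ 2 - ⟪σ, p⟫ ^ 2 / w)
        - ψ * b₁ * f / W + 2 * ψ * f * ⟪σ, p⟫ / (s * W) + W * ψ * ⟪d, q⟫
        + ψ * (‖q‖ ^ 2 - ⟪q, p⟫ ^ 2 / w) := by
  have hw0 : 0 < w := hWw ▸ pow_pos hW 2
  have hsum := Finset.sum_nonpos fun i (_ : i ∈ Finset.univ) => hmax (e i - (c * ⟪p, e i⟫) • p)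
  set N := ∑ i, ‖e i - (c * ⟪p, e i⟫) • p‖ ^ 2
  set T := ∑ i, ‖A (e i - (c * ⟪p, e i⟫) • p)‖ ^ 2
  have hexp : 2 * (-r * N) / s - 2 * (‖σ‖ ^ 2 - ⟪σ, p⟫ ^ 2 / w) / s ^ 2
      + b₂ * (‖p‖ ^ 2 - ⟪p, p⟫ ^ 2 / w) + b₁ * (W * f)
      + 2 * ((∑ i, ⟪B (e i), e i⟫ - ⟪B p, p⟫ / w) + T) / (w * ψ)
      - 4 * (‖A p‖ ^ 2 - ⟪A p, p⟫ ^ 2 / w) * (ψ + 1) / (w * ψ) ^ 2 ≤ 0 := by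
    refine le_of_eq_of_le ?_ hsum
    simp only [Finset.sum_add_distrib, Finset.sum_sub_distrib, ← Finset.mul_sum,
      ← Finset.sum_div, ← Finset.sum_mul, sum_inner_sq_tilted_frame e p _ hc,
      sum_inner_tilted_frame e p hc, heq, N, T]
  have hqp : ⟪q, p⟫ = 2 / s * ⟪σ, p⟫ + b₁ * ‖p‖ ^ 2 := by
    rw [hq, inner_add_left, real_inner_smul_left, real_inner_smul_left,
      real_inner_self_eq_norm_sq]
  have h1 : ⟪A p, p⟫ = -(w * ψ / 2) * ⟪q, p⟫ := by rw [hAp, real_inner_smul_left]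
  have h2 : ⟪d, A p⟫ = -(w * ψ / 2) * ⟪d, q⟫ := by rw [hAp, real_inner_smul_right]
  have h3 : ‖A p‖ ^ 2 = (w * ψ / 2) ^ 2 * ‖q‖ ^ 2 := by
    rw [hAp, norm_smul, mul_pow, Real.norm_eq_abs, sq_abs, neg_sq]
  rw [hdeq, h1, h2, h3, real_inner_self_eq_norm_sq] at hexp
  have hmul := mul_nonpos_of_nonneg_of_nonpos hψ.le hexp
  refine sub_nonpos.mp (le_of_eq_of_le ?_ hmul)
  have hp : ‖p‖ ^ 2 = W ^ 2 - 1 := by rw [hWw, hw]; ring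
  rw [hqp, hp, ← hWw]
  generalize ⟪σ, p⟫ = x, ⟪d, q⟫ = y, ‖q‖ ^ 2 = z, ‖σ‖ ^ 2 = a
  field_simp
  ring

theorem abs_le_add_of_sq_le_mul {x a b : ℝ} (ha : 0 ≤ a) (hb : 0 ≤ b) (h : x ^ 2 ≤ 4 * (a * b)) :
    |x| ≤ a + b :=
  abs_le_of_sq_le_sq (by nlinarith [sq_nonneg (a - b)]) (by positivity)

/-- The bound at a maximum point of the auxiliary function `s ^ 2 * exp (β u) * ψ`, where
`ψ = log (1 + |∇u| ^ 2)`. -/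
theorem maximum_point_bound (e : OrthonormalBasis ι ℝ V) {A B : V →L[ℝ] V}
    {p q σ d : V} {n m₁ m₂ w W s ρ b₁ b₂ f ψ : ℝ} (hn : n = Fintype.card ι) (hn0 : 0 < n)
    (hm₁ : 0 < m₁) (hm₂ : 0 < m₂)
    (hA : ∀ x y, ⟪A x, y⟫ = ⟪x, A y⟫) (hp0 : p ≠ 0)
    (hs : 0 < s) (hs1 : s ≤ 1) (hρ : 0 < ρ) (hσ : ‖σ‖ ≤ 2 / ρ)
    (hW : 0 < W) (hWw : W ^ 2 = w) (hw : w = 1 + ‖p‖ ^ 2) (hψ : 0 < ψ) (hψp : ψ ≤ ‖p‖ ^ 2)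
    (hb₁ : 0 < b₁) (hb₂ : (n / 2 + 2 + n / m₁) * b₁ ^ 2 ≤ b₂)
    (hf : |f| ≤ m₂) (hd : m₁ * w ^ 2 * ψ * ‖d‖ ^ 2 ≤ f ^ 2)
    (hq : q = (2 / s) • σ + b₁ • p) (hAp : A p = -(w * ψ / 2) • q)
    (hmax : ∀ v, 2 * (-(2 / ρ ^ 2) * ‖v‖ ^ 2) / s - 2 * ⟪σ, v⟫ ^ 2 / s ^ 2 + b₂ * ⟪p, v⟫ ^ 2
      + b₁ * ⟪A v, v⟫ + 2 * (⟪B v, v⟫ + ‖A v‖ ^ 2) / (w * ψ)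
      - 4 * ⟪A p, v⟫ ^ 2 * (ψ + 1) / (w * ψ) ^ 2 ≤ 0)
    (heq : ∑ i, ⟪A (e i), e i⟫ - ⟪A p, p⟫ / w = W * f)
    (hdeq : ∑ i, ⟪B (e i), e i⟫ - ⟪B p, p⟫ / w =
      2 / w * (‖A p‖ ^ 2 - ⟪A p, p⟫ ^ 2 / w) + ⟪A p, p⟫ * f / W + W * ⟪d, A p⟫) :
    s ^ 2 * ψ * b₁ ^ 2 ≤ 16 * ((4 * n + 40 + 16 * n / m₁) / ρ ^ 2 + 4 * m₂ / ρ) := by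
  have hw0 : 0 < w := hWw ▸ pow_pos hW 2
  have hp : 0 < ‖p‖ := norm_pos_iff.2 hp0
  have hs2 : s ^ 2 ≤ s := pow_le_of_le_one hs.le hs1 two_ne_zero
  have hpw : ‖p‖ ≤ W := le_of_sq_le_sq (by linarith) hW.le
  by_cases hcase : b₁ * ‖p‖ * (ρ * s) < 8
  · have h1 : s ^ 2 * ψ * b₁ ^ 2 * ρ ^ 2 ≤ 64 := by
      calc s ^ 2 * ψ * b₁ ^ 2 * ρ ^ 2 ≤ s ^ 2 * ‖p‖ ^ 2 * b₁ ^ 2 * ρ ^ 2 := by gcongr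
        _ = (b₁ * ‖p‖ * (ρ * s)) ^ 2 := by ring
        _ ≤ 8 ^ 2 := by gcongr
        _ = 64 := by norm_num
    have h2 : 16 * ((4 * n + 40 + 16 * n / m₁) / ρ ^ 2 + 4 * m₂ / ρ) =
        64 / ρ ^ 2 + (16 * (4 * n + 36 + 16 * n / m₁) / ρ ^ 2 + 64 * m₂ / ρ) := by
      field_simp
      ring
    have h3 : 0 ≤ 16 * (4 * n + 36 + 16 * n / m₁) / ρ ^ 2 + 64 * m₂ / ρ := by positivity
    rw [h2]
    linarith [(le_div_iff₀ (by positivity)).2 h1]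
  push Not at hcase
  obtain ⟨c, hc⟩ : ∃ c, 2 * c - c ^ 2 * ‖p‖ ^ 2 = 1 / w := by
    refine ⟨1 / (W * (W + 1)), ?_⟩
    have : ‖p‖ ^ 2 = W ^ 2 - 1 := by rw [hWw, hw]; ring
    rw [this, ← hWw]
    field_simp
    ring
  have key := contracted_maximum_inequality e hc hs hW hWw hw hψ hq hAp hmax heq hdeq
  have hN := sum_norm_sq_tilted_frame_le e p hc hw0
  have hT1 := sq_tilted_trace_le e p hc hw0 A
  have hT2 := tilted_norm_sq_apply_le e p hc A hA
  have hQ := tilted_norm_sq_add_le e p ((2 / s) • σ) (b₁ • p) hc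
  rw [heq, ← hn, mul_pow, hWw] at hT1
  rw [← hn] at hN
  set N := ∑ i, ‖e i - (c * ⟪p, e i⟫) • p‖ ^ 2
  set T := ∑ i, ‖A (e i - (c * ⟪p, e i⟫) • p)‖ ^ 2
  rw [← hq] at hQ
  set Q := ‖q‖ ^ 2 - ⟪q, p⟫ ^ 2 / w with hQdef
  clear_value N T Q
  have hcs : ∀ x : V, ⟪x, p⟫ ^ 2 ≤ ‖x‖ ^ 2 * ‖p‖ ^ 2 := fun x => by
    rw [← mul_pow]
    exact sq_le_sq' (neg_le_of_abs_le (abs_real_inner_le_norm _ _)) (real_inner_le_norm _ _)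
  have hpwp : ‖p‖ ^ 2 - (‖p‖ ^ 2) ^ 2 / w = ‖p‖ ^ 2 / w := by
    rw [hw]
    field_simp
    ring
  -- the ellipticity bounds for `Q`
  have hQq : ‖q‖ ^ 2 / w ≤ Q := by
    rw [hQdef, le_sub_iff_add_le, ← add_div, div_le_iff₀ hw0, hw]
    linarith [hcs q]
  have hQlow : ⟪q, p⟫ ^ 2 ≤ w * ‖p‖ ^ 2 * Q := by
    have : w * ‖p‖ ^ 2 * Q - ⟪q, p⟫ ^ 2 = w * (‖q‖ ^ 2 * ‖p‖ ^ 2 - ⟪q, p⟫ ^ 2) := by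
      rw [hQdef]
      field_simp
      rw [hw]
      ring
    exact sub_nonneg.1 (this ▸ mul_nonneg hw0.le (sub_nonneg.2 (hcs q)))
  have hσ2 : ‖σ‖ ^ 2 - ⟪σ, p⟫ ^ 2 / w ≤ 4 / ρ ^ 2 := by
    have h1 : ‖σ‖ ^ 2 ≤ (2 / ρ) ^ 2 := by gcongr
    have h2 : 0 ≤ ⟪σ, p⟫ ^ 2 / w := by positivity
    have h3 : (2 / ρ) ^ 2 = 4 / ρ ^ 2 := by rw [div_pow]; norm_num
    linarith
  have hQup : Q ≤ 32 / (ρ ^ 2 * s ^ 2) + 2 * b₁ ^ 2 * (‖p‖ ^ 2 / w) := by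
    have h1 : 8 / s ^ 2 * (‖σ‖ ^ 2 - ⟪σ, p⟫ ^ 2 / w) ≤ 8 / s ^ 2 * (4 / ρ ^ 2) := by gcongr
    rw [← hpwp]
    refine hQ.trans ?_
    simp only [norm_smul, real_inner_smul_left, real_inner_self_eq_norm_sq, mul_pow,
      Real.norm_eq_abs, sq_abs]
    have h2 : 32 / (ρ ^ 2 * s ^ 2) = 8 / s ^ 2 * (4 / ρ ^ 2) := by field_simp; norm_num
    rw [h2]
    refine le_of_eq_of_le ?_ (add_le_add_left h1 _)
    field_simp
    ring
  have hQ0 : 0 ≤ Q := le_trans (by positivity) hQq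
  -- the terms containing `f`
  have hX : W * ψ * ⟪d, q⟫ ≤ f ^ 2 / (2 * n) + n / (2 * m₁) * ψ * Q := by
    refine (le_abs_self _).trans (abs_le_add_of_sq_le_mul (by positivity) (by positivity) ?_)
    have h1 : ⟪d, q⟫ ^ 2 ≤ ‖d‖ ^ 2 * ‖q‖ ^ 2 := by
      rw [← mul_pow]
      exact sq_le_sq' (neg_le_of_abs_le (abs_real_inner_le_norm _ _)) (real_inner_le_norm _ _)
    have h2 : ‖q‖ ^ 2 ≤ Q * w := (div_le_iff₀ hw0).1 hQq
    calc (W * ψ * ⟪d, q⟫) ^ 2 = w * ψ ^ 2 * ⟪d, q⟫ ^ 2 := by rw [← hWw]; ring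
      _ ≤ w * ψ ^ 2 * (‖d‖ ^ 2 * (Q * w)) := by gcongr; exact h1.trans (by gcongr)
      _ = (m₁ * w ^ 2 * ψ * ‖d‖ ^ 2) * (ψ * Q / m₁) := by field_simp
      _ ≤ f ^ 2 * (ψ * Q / m₁) := by gcongr
      _ = _ := by field_simp; norm_num
  have hF : -(ψ * b₁ * f / W) ≤ f ^ 2 / (2 * n) + n / 2 * b₁ ^ 2 * ψ * (‖p‖ ^ 2 / w) := by
    refine (neg_le_abs _).trans (abs_le_add_of_sq_le_mul (by positivity) (by positivity) ?_)
    calc (ψ * b₁ * f / W) ^ 2 = f ^ 2 * b₁ ^ 2 * ψ * (ψ / w) := by rw [← hWw]; ring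
      _ ≤ f ^ 2 * b₁ ^ 2 * ψ * (‖p‖ ^ 2 / w) := by gcongr
      _ = _ := by field_simp; norm_num
  have hσp : |⟪σ, p⟫| ≤ 2 / ρ * ‖p‖ := (abs_real_inner_le_norm _ _).trans (by gcongr)
  have hS : 2 * ψ * f * ⟪σ, p⟫ / (s * W) ≤ ψ / s ^ 2 * (4 * m₂ / ρ) := by
    have h1 : f * ⟪σ, p⟫ ≤ m₂ * (2 / ρ * W) :=
      (le_abs_self _).trans (by rw [abs_mul]; gcongr; exact hσp.trans (by gcongr))
    calc 2 * ψ * f * ⟪σ, p⟫ / (s * W) = 2 * ψ / (s * W) * (f * ⟪σ, p⟫) := by ring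
      _ ≤ 2 * ψ / (s * W) * (m₂ * (2 / ρ * W)) := by gcongr
      _ = ψ / s * (4 * m₂ / ρ) := by field_simp; norm_num
      _ ≤ _ := by gcongr
  -- the good terms
  have hG1 : f ^ 2 / n ≤ T / w := by
    rw [div_le_div_iff₀ hn0 hw0]
    linarith
  have hqp : b₁ * ‖p‖ ^ 2 / 2 ≤ ⟪q, p⟫ := by
    have h1 : ⟪q, p⟫ = 2 / s * ⟪σ, p⟫ + b₁ * ‖p‖ ^ 2 := by
      rw [hq, inner_add_left, real_inner_smul_left, real_inner_smul_left,
        real_inner_self_eq_norm_sq]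
    have h2 : 2 / s * -⟪σ, p⟫ ≤ 2 / s * (2 / ρ * ‖p‖) := by
      gcongr
      exact (neg_le_abs _).trans hσp
    have h3 : 2 / s * (2 / ρ * ‖p‖) = 8 / (ρ * s) * (‖p‖ / 2) := by field_simp; norm_num
    have h4 : 8 / (ρ * s) * (‖p‖ / 2) ≤ b₁ * ‖p‖ * (‖p‖ / 2) := by
      gcongr
      exact (div_le_iff₀ (by positivity)).2 hcase
    linarith
  have hG2 : ψ ^ 2 * b₁ ^ 2 / 16 ≤ T / w := by
    have h1 : (b₁ * ‖p‖ ^ 2 / 2) ^ 2 ≤ w * ‖p‖ ^ 2 * Q := (by gcongr : _ ≤ _).trans hQlow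
    have h2 : ‖A p‖ ^ 2 - ⟪A p, p⟫ ^ 2 / w = (w * ψ / 2) ^ 2 * Q := by
      rw [hAp, real_inner_smul_left, norm_smul, mul_pow, Real.norm_eq_abs, sq_abs, hQdef]
      ring
    rw [h2] at hT2
    have h3 : b₁ ^ 2 * ‖p‖ ^ 2 / 4 ≤ w * Q := by
      refine le_of_mul_le_mul_right ?_ (pow_pos hp 2)
      linarith
    rw [le_div_iff₀ hw0]
    refine le_of_mul_le_mul_left ?_ (pow_pos hp 2)
    calc ‖p‖ ^ 2 * (ψ ^ 2 * b₁ ^ 2 / 16 * w) = w * ψ ^ 2 / 4 * (b₁ ^ 2 * ‖p‖ ^ 2 / 4) := by ring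
      _ ≤ w * ψ ^ 2 / 4 * (w * Q) := by gcongr
      _ = (w * ψ / 2) ^ 2 * Q := by ring
      _ ≤ _ := hT2
  have hR : 2 * (2 / ρ ^ 2) * ψ / s * N ≤ ψ / s ^ 2 * (4 * n / ρ ^ 2) := by
    calc 2 * (2 / ρ ^ 2) * ψ / s * N ≤ 2 * (2 / ρ ^ 2) * ψ / s * n := by gcongr
      _ = ψ / s * (4 * n / ρ ^ 2) := by ring
      _ ≤ _ := by gcongr
  have hσ3 : 2 * ψ / s ^ 2 * (‖σ‖ ^ 2 - ⟪σ, p⟫ ^ 2 / w) ≤ 2 * ψ / s ^ 2 * (4 / ρ ^ 2) := by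
    gcongr
  have hQ2 : (1 + n / (2 * m₁)) * ψ * Q ≤
      (1 + n / (2 * m₁)) * ψ * (32 / (ρ ^ 2 * s ^ 2) + 2 * b₁ ^ 2 * (‖p‖ ^ 2 / w)) := by gcongr
  have hB : ψ * (‖p‖ ^ 2 / w) * ((n / 2 + 2 + n / m₁) * b₁ ^ 2) ≤ ψ * (‖p‖ ^ 2 / w) * b₂ := by
    gcongr
  have hfinal : ψ ^ 2 * b₁ ^ 2 / 16 ≤
      ψ / s ^ 2 * ((4 * n + 40 + 16 * n / m₁) / ρ ^ 2 + 4 * m₂ / ρ) := by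
    linear_combination key + hX + hF + hS + hG1 + hG2 + hR + hσ3 + hQ2 + hB
  refine le_of_mul_le_mul_left ?_ (by positivity : (0 : ℝ) < ψ / (16 * s ^ 2))
  refine (le_of_eq_of_le ?_ hfinal).trans_eq ?_
  · field_simp
  · field_simp

end

theorem deriv_nonpos_of_isLocalMax {φ φ₁ : ℝ → ℝ} {c : ℝ}
    (hφ : ∀ᶠ t in 𝓝 0, HasDerivAt φ (φ₁ t) t) (hφ₁ : HasDerivAt φ₁ c 0)
    (hmax : IsLocalMax φ 0) : c ≤ 0 := by
  by_contra! hc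
  have heq : deriv φ =ᶠ[𝓝 0] φ₁ := hφ.mono fun t ht => ht.deriv
  have hmin : IsLocalMin φ 0 := by
    refine isLocalMin_of_deriv_deriv_pos ?_ hmax.deriv_eq_zero hφ.self_of_nhds.continuousAt
    rw [heq.deriv_eq, hφ₁.deriv]
    exact hc
  have hconst : φ =ᶠ[𝓝 0] fun _ => φ 0 := by
    filter_upwards [hmin, hmax] with t h1 h2 using le_antisymm h2 h1
  have h0 : φ₁ =ᶠ[𝓝 0] fun _ => 0 := by
    filter_upwards [hconst.eventuallyEq_nhds, hφ] with t h1 h2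
    exact h2.unique ((hasDerivAt_const t (φ 0)).congr_of_eventuallyEq h1)
  exact hc.ne' (hφ₁.unique ((hasDerivAt_const (0 : ℝ) (0 : ℝ)).congr_of_eventuallyEq h0))

theorem log_barrier_derivatives {s s₁ u u₁ h h₁ β β₁ : ℝ → ℝ} {s₂ u₂ h₂ b₂ : ℝ}
    (hs : ∀ᶠ t in 𝓝 0, HasDerivAt s (s₁ t) t) (hs₁ : HasDerivAt s₁ s₂ 0)
    (hu : ∀ᶠ t in 𝓝 0, HasDerivAt u (u₁ t) t) (hu₁ : HasDerivAt u₁ u₂ 0)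
    (hh : ∀ᶠ t in 𝓝 0, HasDerivAt h (h₁ t) t) (hh₁ : HasDerivAt h₁ h₂ 0)
    (hβ : ∀ y, HasDerivAt β (β₁ y) y) (hβ₁ : HasDerivAt β₁ b₂ (u 0))
    (hs0 : 0 < s 0) (hh0 : 0 < h 0)
    (hmax : IsLocalMax (fun t => 2 * log (s t) + β (u t) + log (log (1 + 2 * h t))) 0) :
    2 * s₁ 0 / s 0 + β₁ (u 0) * u₁ 0 + 2 * h₁ 0 / ((1 + 2 * h 0) * log (1 + 2 * h 0)) = 0 ∧
    2 * s₂ / s 0 - 2 * s₁ 0 ^ 2 / s 0 ^ 2 + b₂ * u₁ 0 ^ 2 + β₁ (u 0) * u₂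
      + 2 * h₂ / ((1 + 2 * h 0) * log (1 + 2 * h 0))
      - 4 * h₁ 0 ^ 2 * (log (1 + 2 * h 0) + 1) / ((1 + 2 * h 0) * log (1 + 2 * h 0)) ^ 2 ≤ 0 := by
  set φ₁ : ℝ → ℝ := fun t => 2 * (s₁ t / s t) + β₁ (u t) * u₁ t
    + 2 * h₁ t / ((1 + 2 * h t) * log (1 + 2 * h t)) with hφ₁
  have hs0' := hs.self_of_nhds
  have hu0' := hu.self_of_nhds
  have hh0' := hh.self_of_nhds
  have hl0 : 0 < log (1 + 2 * h 0) := log_pos (by linarith)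
  have hd : ∀ᶠ t in 𝓝 0, HasDerivAt
      (fun t => 2 * log (s t) + β (u t) + log (log (1 + 2 * h t))) (φ₁ t) t := by
    filter_upwards [hs, hu, hh, hs0'.continuousAt.eventually (lt_mem_nhds hs0),
      hh0'.continuousAt.eventually (lt_mem_nhds hh0)] with t h1 h2 h3 h4 h5
    have h6 : 0 < log (1 + 2 * h t) := log_pos (by linarith)
    have h7 : 0 < 1 + 2 * h t := by linarith
    refine ((((h1.log h4.ne').const_mul 2).add ((hβ (u t)).comp t h2)).add
      ((((h3.const_mul 2).const_add 1).log h7.ne').log h6.ne')).congr_deriv ?_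
    simp only [hφ₁, div_div]
  have h7 : 0 < 1 + 2 * h 0 := by linarith
  have hd1 := (((hs₁.div hs0' hs0.ne').const_mul 2).add ((hβ₁.comp 0 hu0').mul hu₁)).add
    ((hh₁.const_mul 2).div (((hh0'.const_mul 2).const_add 1).mul
      (((hh0'.const_mul 2).const_add 1).log h7.ne')) (mul_pos h7 hl0).ne')
  have key := deriv_nonpos_of_isLocalMax hd hd1 hmax
  have key0 := hmax.hasDerivAt_eq_zero hd.self_of_nhds
  constructor
  · refine Eq.trans ?_ key0
    simp only [hφ₁]
    ring
  · simp only [Pi.mul_apply, Function.comp] at key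
    refine le_of_eq_of_le ?_ key
    field_simp
    ring


theorem ContDiffOn.hasFDerivAt_of_isOpen {V W : Type*} [NormedAddCommGroup V]
    [NormedSpace ℝ V] [NormedAddCommGroup W] [NormedSpace ℝ W]
    {U : Set V} (hU : IsOpen U) {g : V → W} {k : WithTop ℕ∞} (hg : ContDiffOn ℝ k g U)
    (hk : k ≠ 0) {x : V} (hx : x ∈ U) : HasFDerivAt g (fderiv ℝ g x) x :=
  ((hg.contDiffAt (hU.mem_nhds hx)).differentiableAt hk).hasFDerivAt

theorem hasDerivAt_add_smul {V : Type*} [NormedAddCommGroup V] [NormedSpace ℝ V] (x v : V) (t : ℝ) :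
    HasDerivAt (fun t : ℝ => x + t • v) v t := by
  simpa using ((hasDerivAt_id t).smul_const v).const_add x

section
variable {V : Type*} [NormedAddCommGroup V] [InnerProductSpace ℝ V] [CompleteSpace V]

theorem ContDiffOn.gradient_of_isOpen {U : Set V} (hU : IsOpen U) {u : V → ℝ} {m k : WithTop ℕ∞}
    (hu : ContDiffOn ℝ k u U) (hmk : m + 1 ≤ k) : ContDiffOn ℝ m (gradient u) U :=
  (InnerProductSpace.toDual ℝ V).symm.contDiff.comp_contDiffOn (hu.fderiv_of_isOpen hU hmk)

variable {U : Set V} {u : V → ℝ} {x : V}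

theorem inner_fderiv_gradient_comm (hU : IsOpen U) (hu : ContDiffOn ℝ 3 u U) (hx : x ∈ U)
    (a b : V) : ⟪fderiv ℝ (gradient u) x a, b⟫ = ⟪a, fderiv ℝ (gradient u) x b⟫ := by
  have hg := (hu.gradient_of_isOpen hU (m := 2) (by norm_num)).hasFDerivAt_of_isOpen hU
    two_ne_zero hx
  have hD := (hu.fderiv_of_isOpen hU (m := 2) (by norm_num)).hasFDerivAt_of_isOpen hU
    two_ne_zero hx
  have key : ∀ a b, fderiv ℝ (fderiv ℝ u) x a b = ⟪fderiv ℝ (gradient u) x a, b⟫ := fun a b => by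
    have h1 := hD.clm_apply (hasFDerivAt_const b x)
    have h2 := hg.inner ℝ (hasFDerivAt_const b x)
    simp only [inner_gradient_left] at h2
    simpa using congrArg (fun T => T a) (h1.unique h2)
  have hsymm : IsSymmSndFDerivAt ℝ u x :=
    (hu.contDiffAt (hU.mem_nhds hx)).isSymmSndFDerivAt (by norm_num)
  rw [← key, hsymm a b, key, real_inner_comm]

/-- The third derivatives of `u` are symmetric. -/
theorem inner_fderiv_fderiv_gradient_swap (hU : IsOpen U) (hu : ContDiffOn ℝ 3 u U) (hx : x ∈ U)
    (v p : V) : ⟪fderiv ℝ (fderiv ℝ (gradient u)) x v v, p⟫ =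
      ⟪fderiv ℝ (fderiv ℝ (gradient u)) x p v, v⟫ := by
  have hg := hu.gradient_of_isOpen hU (m := 2) (by norm_num)
  have hD := (hg.fderiv_of_isOpen hU (m := 1) (by norm_num)).hasFDerivAt_of_isOpen hU
    one_ne_zero hx
  have hsymm : IsSymmSndFDerivAt ℝ (gradient u) x :=
    (hg.contDiffAt (hU.mem_nhds hx)).isSymmSndFDerivAt (by simp)
  rw [hsymm p v]
  have h1 := (hD.clm_apply (hasFDerivAt_const v x)).inner ℝ (hasFDerivAt_const p x)
  have h2 := (hasFDerivAt_const v x).inner ℝ (hD.clm_apply (hasFDerivAt_const p x))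
  have h3 : (fun y => ⟪fderiv ℝ (gradient u) y v, p⟫) =ᶠ[𝓝 x]
      fun y => ⟪v, fderiv ℝ (gradient u) y p⟫ := by
    filter_upwards [hU.mem_nhds hx] with y hy using inner_fderiv_gradient_comm hU hu hy v p
  rw [real_inner_comm _ (fderiv ℝ (fderiv ℝ (gradient u)) x v p)]
  simpa using congrArg (fun T => T v) ((h1.congr_of_eventuallyEq h3.symm).unique h2)

/-- The mean curvature equation differentiated in the direction of the gradient. -/
theorem differentiated_equation {ι : Type*} [Fintype ι] (e : OrthonormalBasis ι ℝ V)
    (hU : IsOpen U) (hu : ContDiffOn ℝ 3 u U) (hx : x ∈ U) {f : V → ℝ}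
    (hf : DifferentiableAt ℝ f (gradient u x))
    (heq : ∀ y ∈ U, ∑ i, ⟪fderiv ℝ (gradient u) y (e i), e i⟫
      - ⟪fderiv ℝ (gradient u) y (gradient u y), gradient u y⟫ / (1 + ‖gradient u y‖ ^ 2) =
      √(1 + ‖gradient u y‖ ^ 2) * f (gradient u y))
    {A B : V →L[ℝ] V} {p : V} {w : ℝ} (hp : p = gradient u x) (hA : A = fderiv ℝ (gradient u) x)
    (hB : B = fderiv ℝ (fderiv ℝ (gradient u)) x p) (hw : w = 1 + ‖p‖ ^ 2) :
    ∑ i, ⟪B (e i), e i⟫ - ⟪B p, p⟫ / w =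
      2 / w * (‖A p‖ ^ 2 - ⟪A p, p⟫ ^ 2 / w) + ⟪A p, p⟫ * f p / √w
        + √w * ⟪gradient f p, A p⟫ := by
  have hw0 : 0 < w := by rw [hw]; positivity
  have hgU := hu.gradient_of_isOpen hU (m := 2) (by norm_num)
  have hγ := hasDerivAt_add_smul x p 0
  have hγ0 : x + (0 : ℝ) • p = x := by simp
  have hg : HasDerivAt (fun t : ℝ => gradient u (x + t • p)) (A p) 0 := by
    rw [hA]
    exact HasFDerivAt.comp_hasDerivAt_of_eq (0 : ℝ)
      (hgU.hasFDerivAt_of_isOpen hU two_ne_zero hx) hγ hγ0.symm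
  have hD : HasDerivAt (fun t : ℝ => fderiv ℝ (gradient u) (x + t • p)) B 0 := by
    rw [hB]
    exact HasFDerivAt.comp_hasDerivAt_of_eq (0 : ℝ)
      ((hgU.fderiv_of_isOpen hU (m := 1) (by norm_num)).hasFDerivAt_of_isOpen hU one_ne_zero hx)
      hγ hγ0.symm
  have hF : HasDerivAt (fun t : ℝ => f (gradient u (x + t • p))) ⟪gradient f p, A p⟫ 0 := by
    have := HasFDerivAt.comp_hasDerivAt_of_eq (0 : ℝ) hf.hasFDerivAt hg (by rw [hγ0])
    rwa [← inner_gradient_left, ← hp] at this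
  have hN := (hg.norm_sq).const_add 1
  have hNpos : 1 + ‖gradient u (x + (0 : ℝ) • p)‖ ^ 2 ≠ 0 := by positivity
  have hR := (hN.sqrt hNpos).mul hF
  have hS := HasDerivAt.fun_sum fun i (_ : i ∈ Finset.univ) =>
    (hD.clm_apply (hasDerivAt_const (0 : ℝ) (e i))).inner ℝ (hasDerivAt_const (0 : ℝ) (e i))
  have hL := hS.sub (((hD.clm_apply hg).inner ℝ hg).div hN hNpos)
  have hev : ∀ᶠ t : ℝ in 𝓝 0, x + t • p ∈ U :=
    hγ.continuousAt.eventually (by simp only [hγ0]; exact hU.mem_nhds hx)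
  have huniq := (hL.congr_of_eventuallyEq (hev.mono fun t ht => (heq _ ht).symm)).unique hR
  simp only [hγ0, ← hp, ← hA, ← hw, map_zero, inner_zero_right, add_zero, zero_add,
    inner_add_left] at huniq
  have hAA : ⟪A (A p), p⟫ = ‖A p‖ ^ 2 := by
    rw [hA, inner_fderiv_gradient_comm hU hu hx, real_inner_self_eq_norm_sq]
  rw [hAA, real_inner_self_eq_norm_sq, real_inner_comm (A p) p] at huniq
  have hw1 : √w ≠ 0 := (sqrt_pos.2 hw0).ne'
  rw [sub_eq_iff_eq_add] at huniq
  rw [huniq]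
  field_simp
  ring

/-- The first and second order conditions at a maximum point of the auxiliary function. -/
theorem second_order_condition (hU : IsOpen U) (hu : ContDiffOn ℝ 3 u U) (hx : x ∈ U)
    {β β₁ : ℝ → ℝ} {b₂ κ : ℝ} (hβ : ∀ y, HasDerivAt β (β₁ y) y) (hβ₁ : HasDerivAt β₁ b₂ (u x))
    (hmax : IsLocalMax (fun y => 2 * log (1 - κ * ‖y‖ ^ 2) + β (u y)
      + log (log (1 + ‖gradient u y‖ ^ 2))) x)
    {A B : V →L[ℝ] V} {p σ : V} {w s ψ : ℝ} (hp : p = gradient u x) (hp0 : p ≠ 0)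
    (hA : A = fderiv ℝ (gradient u) x)
    (hB : B = fderiv ℝ (fderiv ℝ (gradient u)) x p) (hw : w = 1 + ‖p‖ ^ 2) (hψ : ψ = log w)
    (hs : s = 1 - κ * ‖x‖ ^ 2) (hs0 : 0 < s) (hσ : σ = -(2 * κ) • x) :
    A p = -(w * ψ / 2) • ((2 / s) • σ + β₁ (u x) • p) ∧
    ∀ v, 2 * (-(2 * κ) * ‖v‖ ^ 2) / s - 2 * ⟪σ, v⟫ ^ 2 / s ^ 2 + b₂ * ⟪p, v⟫ ^ 2
      + β₁ (u x) * ⟪A v, v⟫ + 2 * (⟪B v, v⟫ + ‖A v‖ ^ 2) / (w * ψ)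
      - 4 * ⟪A p, v⟫ ^ 2 * (ψ + 1) / (w * ψ) ^ 2 ≤ 0 := by
  have hpn : 0 < ‖p‖ ^ 2 := pow_pos (norm_pos_iff.2 hp0) 2
  have hw0 : 0 < w := by rw [hw]; positivity
  have hψ0 : 0 < ψ := by rw [hψ, hw]; exact log_pos (by linarith)
  have hgU := hu.gradient_of_isOpen hU (m := 2) (by norm_num)
  have hline : ∀ v,
      (2 * ⟪σ, v⟫ / s + β₁ (u x) * ⟪p, v⟫ + 2 * ⟪A v, p⟫ / (w * ψ) = 0) ∧
      2 * (-(2 * κ) * ‖v‖ ^ 2) / s - 2 * ⟪σ, v⟫ ^ 2 / s ^ 2 + b₂ * ⟪p, v⟫ ^ 2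
        + β₁ (u x) * ⟪A v, v⟫ + 2 * (⟪B v, v⟫ + ‖A v‖ ^ 2) / (w * ψ)
        - 4 * ⟪A v, p⟫ ^ 2 * (ψ + 1) / (w * ψ) ^ 2 ≤ 0 := fun v => by
    have hγ := hasDerivAt_add_smul x v
    have hγ0 : x + (0 : ℝ) • v = x := by simp
    have hev : ∀ᶠ t : ℝ in 𝓝 0, x + t • v ∈ U :=
      (hγ 0).continuousAt.eventually (by simp only [hγ0]; exact hU.mem_nhds hx)
    have hg : ∀ t : ℝ, x + t • v ∈ U → HasDerivAt (fun t : ℝ => gradient u (x + t • v))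
        (fderiv ℝ (gradient u) (x + t • v) v) t := fun t ht => by
      have := (hgU.hasFDerivAt_of_isOpen hU two_ne_zero ht).comp_hasDerivAt t (hγ t)
      exact this
    have hD : HasDerivAt (fun t : ℝ => fderiv ℝ (gradient u) (x + t • v))
        (fderiv ℝ (fderiv ℝ (gradient u)) x v) 0 :=
      HasFDerivAt.comp_hasDerivAt_of_eq (0 : ℝ)
        ((hgU.fderiv_of_isOpen hU (m := 1) (by norm_num)).hasFDerivAt_of_isOpen hU
          one_ne_zero hx) (hγ 0) hγ0.symm
    have hsd : ∀ t : ℝ, HasDerivAt (fun t : ℝ => 1 - κ * ‖x + t • v‖ ^ 2)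
        (-(2 * κ) * ⟪x + t • v, v⟫) t := fun t =>
      (((hγ t).norm_sq.const_mul κ).const_sub 1).congr_deriv (by ring)
    have hsd1 : HasDerivAt (fun t : ℝ => -(2 * κ) * ⟪x + t • v, v⟫) (-(2 * κ) * ‖v‖ ^ 2) 0 := by
      refine (((hγ 0).inner ℝ (hasDerivAt_const (0 : ℝ) v)).const_mul (-(2 * κ))).congr_deriv ?_
      simp
    have hud : ∀ᶠ t in 𝓝 (0 : ℝ), HasDerivAt (fun t : ℝ => u (x + t • v))
        ⟪gradient u (x + t • v), v⟫ t := by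
      filter_upwards [hev] with t ht
      rw [inner_gradient_left]
      exact (hu.hasFDerivAt_of_isOpen hU three_ne_zero ht).comp_hasDerivAt t (hγ t)
    have hg0 := hg 0 (by rwa [hγ0])
    have hud1 : HasDerivAt (fun t : ℝ => ⟪gradient u (x + t • v), v⟫) ⟪A v, v⟫ 0 := by
      refine (hg0.inner ℝ (hasDerivAt_const (0 : ℝ) v)).congr_deriv ?_
      simp [hA]
    have hhd : ∀ᶠ t in 𝓝 (0 : ℝ), HasDerivAt (fun t : ℝ => ‖gradient u (x + t • v)‖ ^ 2 / 2)
        ⟪fderiv ℝ (gradient u) (x + t • v) v, gradient u (x + t • v)⟫ t := by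
      filter_upwards [hev] with t ht
      refine ((hg t ht).norm_sq.div_const 2).congr_deriv ?_
      rw [real_inner_comm]
      ring
    have hhd1 : HasDerivAt
        (fun t : ℝ => ⟪fderiv ℝ (gradient u) (x + t • v) v, gradient u (x + t • v)⟫)
        (⟪B v, v⟫ + ‖A v‖ ^ 2) 0 := by
      refine ((hD.clm_apply (hasDerivAt_const (0 : ℝ) v)).inner ℝ hg0).congr_deriv ?_
      simp only [hγ0, map_zero, add_zero, ← hA, ← hp]
      rw [inner_fderiv_fderiv_gradient_swap hU hu hx, ← hB, real_inner_self_eq_norm_sq, add_comm]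
    have hmax0 : IsLocalMax (fun t : ℝ => 2 * log (1 - κ * ‖x + t • v‖ ^ 2) + β (u (x + t • v))
        + log (log (1 + 2 * (‖gradient u (x + t • v)‖ ^ 2 / 2)))) 0 := by
      have hc : ContinuousAt (fun t : ℝ => x + t • v) 0 := (hγ 0).continuousAt
      have h1 : Tendsto (fun t : ℝ => x + t • v) (𝓝 0) (𝓝 x) := by
        simpa only [ContinuousAt, hγ0] using hc
      filter_upwards [h1.eventually hmax] with t ht
      simpa only [hγ0, mul_div_cancel₀ _ (two_ne_zero' ℝ)] using ht
    have key := log_barrier_derivatives (Eventually.of_forall hsd) hsd1 hud hud1 hhd hhd1 hβ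
      (by rwa [hγ0]) (by rwa [hγ0, ← hs]) (by rw [hγ0, ← hp]; positivity) hmax0
    have hσv : ⟪σ, v⟫ = -(2 * κ) * ⟪x, v⟫ := by rw [hσ, real_inner_smul_left]
    simp only [hγ0, mul_div_cancel₀ _ (two_ne_zero' ℝ), ← hp, ← hA, ← hw, ← hψ, ← hs,
      ← hσv] at key
    exact key
  have hsymm : ∀ v, ⟪A v, p⟫ = ⟪A p, v⟫ := fun v => by
    rw [hA, inner_fderiv_gradient_comm hU hu hx, real_inner_comm]
  refine ⟨ext_inner_right ℝ fun v => ?_, fun v => hsymm v ▸ (hline v).2⟩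
  have h1 := (hline v).1
  rw [hsymm] at h1
  rw [real_inner_smul_left, inner_add_left, real_inner_smul_left, real_inner_smul_left]
  field_simp at h1 ⊢
  linarith

/-- The auxiliary function attains its maximum over a compact ball at an interior point with
nonzero gradient. -/
theorem exists_isLocalMax_barrier [ProperSpace V] {R ρ : ℝ} (hρ : 0 < ρ) (hρR : ρ < R)
    (hu : ContDiffOn ℝ 1 u (ball 0 R)) {β : ℝ → ℝ} (hβ : Continuous β)
    (hg0 : gradient u 0 ≠ 0) :
    ∃ x, ‖x‖ < ρ ∧ gradient u x ≠ 0 ∧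
      IsLocalMax (fun y => 2 * log (1 - 1 / ρ ^ 2 * ‖y‖ ^ 2) + β (u y)
        + log (log (1 + ‖gradient u y‖ ^ 2))) x ∧
      exp (β (u 0)) * log (1 + ‖gradient u 0‖ ^ 2) ≤
        (1 - 1 / ρ ^ 2 * ‖x‖ ^ 2) ^ 2 * exp (β (u x)) * log (1 + ‖gradient u x‖ ^ 2) := by
  have hgc : ContinuousOn (gradient u) (ball 0 R) :=
    (hu.gradient_of_isOpen isOpen_ball (m := 0) (by norm_num)).continuousOn
  have hlogpos : ∀ y, gradient u y ≠ 0 → 0 < log (1 + ‖gradient u y‖ ^ 2) := fun y hy =>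
    log_pos (by have := pow_pos (norm_pos_iff.2 hy) 2; linarith)
  set G : V → ℝ := fun y =>
    (1 - 1 / ρ ^ 2 * ‖y‖ ^ 2) ^ 2 * exp (β (u y)) * log (1 + ‖gradient u y‖ ^ 2) with hG
  have hsub : closedBall (0 : V) ρ ⊆ ball 0 R := closedBall_subset_ball hρR
  have hGc : ContinuousOn G (closedBall 0 ρ) := by
    have h1 := hgc.mono hsub
    have h2 := hu.continuousOn.mono hsub
    refine ContinuousOn.mul (ContinuousOn.mul (by fun_prop) ?_) ?_
    · exact continuous_exp.comp_continuousOn (hβ.comp_continuousOn h2)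
    · exact ContinuousOn.log (by fun_prop) fun y _ => by positivity
  obtain ⟨x, hx, hmax⟩ := (isCompact_closedBall (0 : V) ρ).exists_isMaxOn
    ⟨0, mem_closedBall_self hρ.le⟩ hGc
  have hG0 : G 0 = exp (β (u 0)) * log (1 + ‖gradient u 0‖ ^ 2) := by simp [hG]
  have hGx : G 0 ≤ G x := hmax (mem_closedBall_self hρ.le)
  have hGpos : 0 < G x := lt_of_lt_of_le (hG0 ▸ mul_pos (exp_pos _) (hlogpos 0 hg0)) hGx
  have hgx : gradient u x ≠ 0 := fun h => by simp [hG, h] at hGpos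
  have hxρ : ‖x‖ < ρ := by
    refine lt_of_le_of_ne (mem_closedBall_zero_iff.1 hx) fun h => ?_
    have : 1 - 1 / ρ ^ 2 * ‖x‖ ^ 2 = 0 := by rw [h]; field_simp; ring
    have hG0' : G x = 0 := by simp only [hG, this]; ring
    exact hGpos.ne' hG0'
  refine ⟨x, hxρ, hgx, ?_, hG0 ▸ hGx⟩
  have hgcx : ContinuousAt (gradient u) x :=
    hgc.continuousAt (isOpen_ball.mem_nhds (hsub hx))
  have hpos : ∀ y, ‖y‖ < ρ → gradient u y ≠ 0 → 0 < 1 - 1 / ρ ^ 2 * ‖y‖ ^ 2 ∧ log (G y) =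
      2 * log (1 - 1 / ρ ^ 2 * ‖y‖ ^ 2) + β (u y) + log (log (1 + ‖gradient u y‖ ^ 2)) ∧
      0 < G y := fun y hy hgy => by
    have h1 : 0 < 1 - 1 / ρ ^ 2 * ‖y‖ ^ 2 := by
      rw [sub_pos, one_div_mul_eq_div, div_lt_one (by positivity)]
      gcongr
    have h2 := hlogpos y hgy
    refine ⟨h1, ?_, by positivity⟩
    rw [hG, log_mul (by positivity) h2.ne', log_mul (by positivity) (exp_pos _).ne', log_pow,
      log_exp]
    norm_num
  filter_upwards [isOpen_ball.mem_nhds (mem_ball_zero_iff.2 hxρ), hgcx.eventually_ne hgx]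
    with y hy hgy
  rw [mem_ball_zero_iff] at hy
  rw [← (hpos y hy hgy).2.1, ← (hpos x hxρ hgx).2.1]
  exact log_le_log (hpos y hy hgy).2.2 (hmax (mem_closedBall_zero_iff.2 hy.le))

end

/-- In coordinates, the mean curvature operator is the trace of the Hessian with respect to the
inverse metric. -/
theorem mcOp_eq_trace {n : ℕ} {U : Set (EuclideanSpace ℝ (Fin n))}
    {u : EuclideanSpace ℝ (Fin n) → ℝ} (hU : IsOpen U) (hu : ContDiffOn ℝ 3 u U)
    {x : EuclideanSpace ℝ (Fin n)} (hx : x ∈ U) :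
    mcOp u x = ∑ i, ⟪fderiv ℝ (gradient u) x (EuclideanSpace.basisFun (Fin n) ℝ i),
        EuclideanSpace.basisFun (Fin n) ℝ i⟫
      - ⟪fderiv ℝ (gradient u) x (gradient u x), gradient u x⟫ / (1 + ‖gradient u x‖ ^ 2) := by
  set D := fderiv ℝ (gradient u) x with hD
  set g := gradient u x with hg
  set e := EuclideanSpace.basisFun (Fin n) ℝ with he
  have hpd1 : ∀ j, pd1 u j = fun y => ⟪gradient u y, e j⟫ := fun j => by
    ext y
    rw [inner_gradient_left, pd1, he, EuclideanSpace.basisFun_apply]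
  have hgd : HasFDerivAt (gradient u) D x :=
    (hu.gradient_of_isOpen hU (m := 2) (by norm_num)).hasFDerivAt_of_isOpen hU
      two_ne_zero hx
  have hpd2 : ∀ i j, pd2 u i j x = ⟪D (e i), e j⟫ := fun i j => by
    rw [pd2, hpd1, (hgd.inner ℝ (hasFDerivAt_const (e j) x)).fderiv]
    simp [he]
  have hpd1x : ∀ j, pd1 u j x = ⟪g, e j⟫ := fun j => by rw [hpd1]
  have h1 : ⟪D g, g⟫ = ∑ i, ∑ j, ⟪g, e i⟫ * ⟪g, e j⟫ * ⟪D (e i), e j⟫ := by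
    conv_lhs => rw [← e.sum_repr' g]
    simp only [map_sum, map_smul, sum_inner, inner_sum, real_inner_smul_left,
      real_inner_smul_right]
    rw [Finset.sum_comm]
    refine Finset.sum_congr rfl fun i _ => Finset.sum_congr rfl fun j _ => ?_
    rw [real_inner_comm g (e i), real_inner_comm g (e j)]
    ring
  simp only [mcOp, aCoef, hpd2, hpd1x, sub_mul, Finset.sum_sub_distrib, ite_mul, one_mul,
    zero_mul, Finset.sum_ite_eq, Finset.mem_univ, if_true, ← hg]
  rw [h1, Finset.sum_div]
  congr 1
  refine Finset.sum_congr rfl fun i _ => ?_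
  rw [Finset.sum_div]
  exact Finset.sum_congr rfl fun j _ => by ring

/-- The bound at an interior local maximum of the auxiliary function. -/
theorem barrier_bound_of_isLocalMax {ι V : Type*} [Fintype ι] [NormedAddCommGroup V]
    [InnerProductSpace ℝ V] [CompleteSpace V] (e : OrthonormalBasis ι ℝ V) {U : Set V} {u : V → ℝ}
    {x : V} {n m₁ m₂ ρ b₂ : ℝ} (hn : n = Fintype.card ι) (hn0 : 0 < n) (hm₁ : 0 < m₁)
    (hm₂ : 0 < m₂) {f : V → ℝ} (hf : DifferentiableAt ℝ f (gradient u x))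
    (hfd : m₁ * (1 + ‖gradient u x‖ ^ 2) ^ 2 * log (1 + ‖gradient u x‖ ^ 2)
      * ‖gradient f (gradient u x)‖ ^ 2 ≤ f (gradient u x) ^ 2)
    (hfb : |f (gradient u x)| ≤ m₂) (hU : IsOpen U) (hu : ContDiffOn ℝ 3 u U) (hx : x ∈ U)
    (heq : ∀ y ∈ U, ∑ i, ⟪fderiv ℝ (gradient u) y (e i), e i⟫
      - ⟪fderiv ℝ (gradient u) y (gradient u y), gradient u y⟫ / (1 + ‖gradient u y‖ ^ 2)
      = √(1 + ‖gradient u y‖ ^ 2) * f (gradient u y))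
    {β β₁ : ℝ → ℝ} (hβ : ∀ y, HasDerivAt β (β₁ y) y) (hβ₁ : HasDerivAt β₁ b₂ (u x))
    (hb₁ : 0 < β₁ (u x)) (hb₂ : (n / 2 + 2 + n / m₁) * β₁ (u x) ^ 2 ≤ b₂)
    (hρ0 : 0 < ρ) (hxρ : ‖x‖ < ρ) (hgx : gradient u x ≠ 0)
    (hmax : IsLocalMax (fun y => 2 * log (1 - 1 / ρ ^ 2 * ‖y‖ ^ 2) + β (u y)
      + log (log (1 + ‖gradient u y‖ ^ 2))) x) :
    (1 - 1 / ρ ^ 2 * ‖x‖ ^ 2) ^ 2 * log (1 + ‖gradient u x‖ ^ 2) * β₁ (u x) ^ 2 ≤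
      16 * ((4 * n + 40 + 16 * n / m₁) / ρ ^ 2 + 4 * m₂ / ρ) := by
  obtain ⟨p, hp⟩ : ∃ p, p = gradient u x := ⟨_, rfl⟩
  obtain ⟨w, hw⟩ : ∃ w, w = 1 + ‖p‖ ^ 2 := ⟨_, rfl⟩
  obtain ⟨ψ, hψ⟩ : ∃ ψ, ψ = log w := ⟨_, rfl⟩
  obtain ⟨s, hs⟩ : ∃ s, s = 1 - 1 / ρ ^ 2 * ‖x‖ ^ 2 := ⟨_, rfl⟩
  have hp0 : p ≠ 0 := hp ▸ hgx
  have hpn : 0 < ‖p‖ ^ 2 := pow_pos (norm_pos_iff.2 hp0) 2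
  have hw0 : 0 < w := by rw [hw]; positivity
  have hs0 : 0 < s := by
    rw [hs, sub_pos, one_div_mul_eq_div, div_lt_one (by positivity)]
    gcongr
  have hs1 : s ≤ 1 := by
    have : 0 ≤ 1 / ρ ^ 2 * ‖x‖ ^ 2 := by positivity
    linarith
  have hψ0 : 0 < ψ := by rw [hψ]; exact log_pos (by linarith)
  have hψp : ψ ≤ ‖p‖ ^ 2 := by
    rw [hψ]; linarith [log_le_sub_one_of_pos hw0]
  have hdeq := differentiated_equation e hU hu hx hf heq hp rfl rfl hw
  obtain ⟨hAp, hsec⟩ := second_order_condition hU hu hx hβ hβ₁ hmax hp hp0 rfl rfl hw hψ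
    hs hs0 rfl
  have hσ : ‖-(2 * (1 / ρ ^ 2)) • x‖ ≤ 2 / ρ := by
    rw [norm_smul, norm_neg, norm_of_nonneg (by positivity)]
    calc 2 * (1 / ρ ^ 2) * ‖x‖ ≤ 2 * (1 / ρ ^ 2) * ρ := by gcongr
      _ = 2 / ρ := by field_simp
  have hbound := maximum_point_bound e (W := √w) hn hn0 hm₁ hm₂
    (fun a b => inner_fderiv_gradient_comm hU hu hx a b) hp0 hs0 hs1 hρ0 hσ
    (sqrt_pos.2 hw0) (sq_sqrt hw0.le) hw hψ0 hψp hb₁ hb₂ (hp ▸ hfb)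
    (by rw [← hp, ← hw, ← hψ] at hfd; exact hfd) rfl hAp
    (fun v => by simpa only [mul_one_div] using hsec v)
    (by have := heq x hx; rw [← hp, ← hw] at this; exact this) hdeq
  rwa [← hs, ← hp, ← hw, ← hψ]

/-- The gradient estimate before optimising the constants. -/
theorem log_one_add_sq_norm_gradient_le {n : ℕ} (hn : 1 ≤ n) {m₁ m₂ R L : ℝ} (hm₁ : 0 < m₁)
    (hm₂ : 0 < m₂) (hR : 0 < R) {f : EuclideanSpace ℝ (Fin n) → ℝ} (hf : ContDiff ℝ 1 f)
    (hfd : ∀ p : EuclideanSpace ℝ (Fin n),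
      f p ^ 2 - m₁ * (1 + ‖p‖ ^ 2) ^ 2 * log (1 + ‖p‖ ^ 2) * ‖gradient f p‖ ^ 2 ≥ 0)
    (hfb : ∀ p, |f p| ≤ m₂) {u : EuclideanSpace ℝ (Fin n) → ℝ}
    (hu1 : ContDiffOn ℝ 1 u (ball 0 R))
    (hu3 : ContDiffOn ℝ 3 u (ball 0 R ∩ {x | gradient u x ≠ 0}))
    (heq : ∀ x ∈ ball (0 : EuclideanSpace ℝ (Fin n)) R, gradient u x ≠ 0 →
      mcOp u x = √(1 + ‖gradient u x‖ ^ 2) * f (gradient u x))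
    (hL : ∀ x ∈ ball (0 : EuclideanSpace ℝ (Fin n)) R,
      ∀ y ∈ ball (0 : EuclideanSpace ℝ (Fin n)) R, |u x - u y| ≤ L)
    (hg0 : gradient u 0 ≠ 0) :
    log (1 + ‖gradient u 0‖ ^ 2) ≤
      3888 * (n / 2 + 2 + n / m₁) ^ 2 * (L + 1) ^ 2 *
        ((4 * n + 40 + 16 * n / m₁) * (4 / R ^ 2) + 4 * m₂ * (2 / R)) := by
  have h0 : (0 : EuclideanSpace ℝ (Fin n)) ∈ ball 0 R := mem_ball_self hR
  have hL0 : 0 ≤ L := (abs_nonneg _).trans (hL 0 h0 0 h0)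
  have hn0 : (0 : ℝ) < n := by exact_mod_cast hn
  obtain ⟨K, hK⟩ : ∃ K : ℝ, K = n / 2 + 2 + n / m₁ := ⟨_, rfl⟩
  have hK2 : 2 ≤ K := by
    have : 0 < n / m₁ := by positivity
    rw [hK]; linarith
  obtain ⟨M, hM⟩ : ∃ M : ℝ, M = L + 1 := ⟨_, rfl⟩
  have hM1 : 1 ≤ M := by linarith
  have hM0 : 0 < M := by linarith
  obtain ⟨δ, hδ⟩ : ∃ δ : ℝ, δ = 1 / (9 * K) := ⟨_, rfl⟩
  have hδ0 : 0 < δ := by rw [hδ]; positivity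
  have hδK : 9 * K * δ = 1 := by rw [hδ]; field_simp
  obtain ⟨ρ, hρ⟩ : ∃ ρ : ℝ, ρ = R / 2 := ⟨_, rfl⟩
  have hρ0 : 0 < ρ := by rw [hρ]; positivity
  have hρR : ρ < R := by rw [hρ]; linarith
  set β : ℝ → ℝ := fun y => δ / 2 * (2 + (y - u 0) / M) ^ 2 with hβ
  have hβd : ∀ y, HasDerivAt β (δ * (2 + (y - u 0) / M) / M) y := fun y => by
    have h := (((((hasDerivAt_id' y).sub_const (u 0)).div_const M).const_add 2).pow 2).const_mul
      (δ / 2)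
    refine h.congr_deriv ?_
    simp only [Nat.cast_ofNat]
    ring
  have hβd2 : ∀ y, HasDerivAt (fun y => δ * (2 + (y - u 0) / M) / M) (δ / M ^ 2) y := fun y => by
    have h := (((((hasDerivAt_id' y).sub_const (u 0)).div_const M).const_add 2).const_mul
      δ).div_const M
    refine h.congr_deriv ?_
    ring
  obtain ⟨x, hxρ, hgx, hmax, hle⟩ := exists_isLocalMax_barrier hρ0 hρR hu1
    (continuous_iff_continuousAt.2 fun y => (hβd y).continuousAt) hg0
  have hxR : x ∈ ball (0 : EuclideanSpace ℝ (Fin n)) R := mem_ball_zero_iff.2 (hxρ.trans hρR)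
  set U : Set (EuclideanSpace ℝ (Fin n)) := ball 0 R ∩ {x | gradient u x ≠ 0} with hUdef
  have hU : IsOpen U :=
    (hu1.gradient_of_isOpen isOpen_ball (m := 0) (by norm_num)).continuousOn.isOpen_inter_preimage
      isOpen_ball isOpen_ne
  have hxU : x ∈ U := ⟨hxR, hgx⟩
  obtain ⟨τ, hτ⟩ : ∃ τ : ℝ, τ = 2 + (u x - u 0) / M := ⟨_, rfl⟩
  have hτb : 1 ≤ τ ∧ τ ≤ 3 := by
    have h1 : |(u x - u 0) / M| ≤ 1 := by
      rw [abs_div, abs_of_pos hM0, div_le_one hM0]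
      linarith [hL x hxR 0 h0]
    have := abs_le.1 h1
    constructor <;> linarith
  have hτ9 : τ ^ 2 ≤ 9 := by
    have := pow_le_pow_left₀ (by linarith) hτb.2 2
    linarith
  set e := EuclideanSpace.basisFun (Fin n) ℝ with he
  have heqU : ∀ y ∈ U, ∑ i, ⟪fderiv ℝ (gradient u) y (e i), e i⟫
      - ⟪fderiv ℝ (gradient u) y (gradient u y), gradient u y⟫ / (1 + ‖gradient u y‖ ^ 2)
      = √(1 + ‖gradient u y‖ ^ 2) * f (gradient u y) := fun y hy => by
    rw [← heq y hy.1 hy.2, mcOp_eq_trace hU hu3 hy]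
  have hb₁ : 0 < δ * (2 + (u x - u 0) / M) / M := by
    rw [← hτ]; have := hτb.1; positivity
  have hb₂ : (n / 2 + 2 + n / m₁) * (δ * (2 + (u x - u 0) / M) / M) ^ 2 ≤ δ / M ^ 2 := by
    rw [← hτ, ← hK]
    calc K * (δ * τ / M) ^ 2 = (K * δ * τ ^ 2) * (δ / M ^ 2) := by ring
      _ ≤ (K * δ * 9) * (δ / M ^ 2) := by gcongr
      _ = δ / M ^ 2 := by rw [show K * δ * 9 = 1 by linarith, one_mul]
  have hbound := barrier_bound_of_isLocalMax e (by simp) hn0 hm₁ hm₂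
    (hf.differentiable (by norm_num) _) (by linarith [hfd (gradient u x)]) (hfb _) hU hu3 hxU heqU
    hβd (hβd2 _) hb₁ hb₂ hρ0 hxρ hgx hmax
  obtain ⟨s, hs⟩ : ∃ s, s = 1 - 1 / ρ ^ 2 * ‖x‖ ^ 2 := ⟨_, rfl⟩
  obtain ⟨ψ, hψ⟩ : ∃ ψ, ψ = log (1 + ‖gradient u x‖ ^ 2) := ⟨_, rfl⟩
  have hψ0 : 0 ≤ ψ := hψ ▸ log_nonneg (by linarith [sq_nonneg ‖gradient u x‖])
  rw [← hτ, ← hs, ← hψ] at hbound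
  have hsψ : s ^ 2 * ψ * δ ^ 2 ≤
      M ^ 2 * (16 * ((4 * n + 40 + 16 * n / m₁) / ρ ^ 2 + 4 * m₂ / ρ)) := by
    calc s ^ 2 * ψ * δ ^ 2 ≤ s ^ 2 * ψ * (δ * τ) ^ 2 := by
          gcongr; exact le_mul_of_one_le_right hδ0.le hτb.1
      _ = M ^ 2 * (s ^ 2 * ψ * (δ * τ / M) ^ 2) := by field_simp
      _ ≤ _ := by gcongr
  have hψ00 : 0 ≤ log (1 + ‖gradient u 0‖ ^ 2) :=
    log_nonneg (by linarith [sq_nonneg ‖gradient u 0‖])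
  have hexp0 : 1 ≤ exp (β (u 0)) := one_le_exp (by positivity)
  have hexpx : exp (β (u x)) ≤ 3 := by
    have : β (u x) ≤ 1 := by
      simp only [hβ, ← hτ]
      calc δ / 2 * τ ^ 2 ≤ δ / 2 * 9 := by gcongr
        _ ≤ 1 := by linarith [mul_le_mul_of_nonneg_right hK2 hδ0.le]
    exact (exp_le_exp.2 this).trans exp_one_lt_three.le
  rw [← hψ, ← hs] at hle
  have hfin : log (1 + ‖gradient u 0‖ ^ 2) ≤ 3 * (s ^ 2 * ψ) := by
    have h1 : log (1 + ‖gradient u 0‖ ^ 2) ≤ exp (β (u 0)) * log (1 + ‖gradient u 0‖ ^ 2) :=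
      le_mul_of_one_le_left hψ00 hexp0
    have h2 : s ^ 2 * exp (β (u x)) * ψ ≤ s ^ 2 * 3 * ψ := by gcongr
    linarith
  rw [← hK, ← hM]
  have hKδ : 81 * K ^ 2 * δ ^ 2 = 1 := by
    rw [show 81 * K ^ 2 * δ ^ 2 = (9 * K * δ) ^ 2 by ring, hδK, one_pow]
  calc log (1 + ‖gradient u 0‖ ^ 2) ≤ 3 * (s ^ 2 * ψ) := hfin
    _ = 3 * (81 * K ^ 2) * (s ^ 2 * ψ * δ ^ 2) := by linear_combination (-3 * (s ^ 2 * ψ)) * hKδ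
    _ ≤ 3 * (81 * K ^ 2) *
        (M ^ 2 * (16 * ((4 * n + 40 + 16 * n / m₁) / ρ ^ 2 + 4 * m₂ / ρ))) := by gcongr
    _ = _ := by rw [hρ]; field_simp; ring

/-- Theorem 1.1 (d): interior gradient estimate under assumption (A4),
in terms of the oscillation `L`. -/
theorem gradient_estimate_A4 (n : ℕ) (hn : 1 ≤ n) (m₁ m₂ : ℝ)
    (hm₁ : 0 < m₁) (hm₂ : 0 < m₂) :
    ∃ C > 0, ∀ R : ℝ, 0 < R →
      ∀ f : EuclideanSpace ℝ (Fin n) → ℝ, ContDiff ℝ 1 f →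
      (∀ p : EuclideanSpace ℝ (Fin n),
        f p ^ 2 - m₁ * (1 + ‖p‖ ^ 2) ^ 2 * Real.log (1 + ‖p‖ ^ 2) * ‖gradient f p‖ ^ 2
          ≥ 0) →
      (∀ p : EuclideanSpace ℝ (Fin n), |f p| ≤ m₂) →
      ∀ u : EuclideanSpace ℝ (Fin n) → ℝ,
        ContDiffOn ℝ 1 u (ball 0 R) →
        ContDiffOn ℝ 3 u (ball 0 R ∩ {x | gradient u x ≠ 0}) →
        (∀ x ∈ ball (0 : EuclideanSpace ℝ (Fin n)) R, gradient u x ≠ 0 →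
          mcOp u x = Real.sqrt (1 + ‖gradient u x‖ ^ 2) * f (gradient u x)) →
        ∀ L : ℝ,
          (∀ x ∈ ball (0 : EuclideanSpace ℝ (Fin n)) R,
            ∀ y ∈ ball (0 : EuclideanSpace ℝ (Fin n)) R, |u x - u y| ≤ L) →
          ‖gradient u 0‖ ^ 2 ≤
            max (Real.exp (C * (L + 1) ^ 2 / R ^ 2) - 1)
              (Real.exp (C * (L + 1) ^ 2 / R ^ ((2 : ℝ) / 3)) - 1) := by
  have hn0 : (0 : ℝ) < n := by exact_mod_cast hn
  refine ⟨3888 * (n / 2 + 2 + n / m₁) ^ 2 * ((4 * n + 40 + 16 * n / m₁) * 4 + 4 * m₂ * 2),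
    by positivity, fun R hR f hf hfd hfb u hu1 hu3 heq L hL => ?_⟩
  by_cases hg0 : gradient u 0 = 0
  · rw [hg0, norm_zero, zero_pow two_ne_zero]
    exact le_max_of_le_left (sub_nonneg.2 (one_le_exp (by positivity)))
  have hlog := log_one_add_sq_norm_gradient_le hn hm₁ hm₂ hR hf hfd hfb hu1 hu3 heq hL hg0
  have hbound : ∀ r > 0, 1 / R ^ 2 ≤ 1 / r → 1 / R ≤ 1 / r → ‖gradient u 0‖ ^ 2 ≤
      exp (3888 * (n / 2 + 2 + n / m₁) ^ 2 * ((4 * n + 40 + 16 * n / m₁) * 4 + 4 * m₂ * 2)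
        * (L + 1) ^ 2 / r) - 1 := fun r hr h1 h2 => by
    rw [le_sub_iff_add_le', ← log_le_iff_le_exp (by positivity)]
    refine hlog.trans ?_
    calc _ = 3888 * (n / 2 + 2 + n / m₁) ^ 2 * (L + 1) ^ 2 *
          ((4 * n + 40 + 16 * n / m₁) * (4 * (1 / R ^ 2)) + 4 * m₂ * (2 * (1 / R))) := by ring
      _ ≤ 3888 * (n / 2 + 2 + n / m₁) ^ 2 * (L + 1) ^ 2 *
          ((4 * n + 40 + 16 * n / m₁) * (4 * (1 / r)) + 4 * m₂ * (2 * (1 / r))) := by gcongr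
      _ = _ := by ring
  rcases le_total R 1 with hR1 | hR1
  · refine le_max_of_le_left (hbound _ (by positivity) le_rfl ?_)
    exact one_div_le_one_div_of_le (by positivity) (by nlinarith)
  · have hr : R ^ ((2 : ℝ) / 3) ≤ R := by
      simpa using rpow_le_rpow_of_exponent_le hR1 (by norm_num : (2 : ℝ) / 3 ≤ 1)
    have hr0 : 0 < R ^ ((2 : ℝ) / 3) := by positivity
    exact le_max_of_le_right (hbound _ hr0
      (one_div_le_one_div_of_le hr0 (hr.trans (by nlinarith))) (one_div_le_one_div_of_le hr0 hr))
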